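/- Let G be a simple graph, let P = x1 x2 … xk be a path of G, and let y, z be two distinct vertices of V(G) − V(P). If d(y, V(P)) + d(z, V(P)) ≥ k + 2, then the induced subgraph G[V(P) ∪ {y, z}] is traceable (it has a Hamiltonian path). -/

import Mathlib

open SimpleGraph

variable {V : Type*}

/-- `d(x, S)`: the number of neighbours of `x` (in the graph `G`) lying in `S`. -/
noncomputable def dOn (G : SimpleGraph V) (x : V) (S : Set V) : ℕ :=
  Nat.card {y : V // y ∈ S ∧ G.Adj x y}

/-- A graph is traceable if it has a Hamiltonian path. -/
def Traceable {α : Type*} (H : SimpleGraph α) : Prop :=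
  ∃ (a b : α) (p : H.Walk a b), p.IsPath ∧ ∀ x, x ∈ p.support

theorem SimpleGraph.traceable_induce_of_isChain {V : Type*} {G : SimpleGraph V} {s : Set V}
    {l : List V} (hne : l ≠ []) (hchain : l.IsChain G.Adj) (hnodup : l.Nodup)
    (hmem : ∀ v, v ∈ l ↔ v ∈ s) : Traceable (G.induce s) := by
  have hs : ∀ v ∈ l, v ∈ s := fun v hv => (hmem v).1 hv
  have hchain' : (l.attachWith (· ∈ s) hs).IsChain (G.induce s).Adj := by
    apply List.isChain_of_isChain_map (R := (G.induce s).Adj) (S := G.Adj) Subtype.val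
    · exact fun _ _ h => h
    · rwa [List.attachWith_map_subtype_val]
  have hne' : l.attachWith (· ∈ s) hs ≠ [] := by simpa using hne
  refine ⟨_, _, Walk.ofSupport _ hne' hchain', ?_, fun x => ?_⟩
  · rw [Walk.isPath_def, Walk.support_ofSupport]
    apply List.Nodup.of_map Subtype.val
    rwa [List.attachWith_map_subtype_val]
  · rw [Walk.support_ofSupport]
    simpa using (hmem x).2 x.2

theorem dOn_le_card_filter_range {V : Type*} (G : SimpleGraph V) (x : V) (l : List V)
    [DecidablePred fun i : ℕ => ∀ v ∈ l[i]?, G.Adj x v] :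
    dOn G x {v | v ∈ l} ≤
      ((Finset.range l.length).filter fun i => ∀ v ∈ l[i]?, G.Adj x v).card := by
  classical
  set N := (Finset.range l.length).filter fun i => ∀ v ∈ l[i]?, G.Adj x v with hN
  have hsub : {v | v ∈ {v | v ∈ l} ∧ G.Adj x v} ⊆ (N.image fun i => l.getD i x : Finset V) := by
    rintro v ⟨hv, hadj⟩
    obtain ⟨i, hi, rfl⟩ := List.getElem_of_mem hv
    simp only [Finset.coe_image, Set.mem_image, Finset.mem_coe]
    exact ⟨i, by simp [hN, hi, hadj], by simp [hi]⟩
  calc dOn G x {v | v ∈ l} = {v | v ∈ {v | v ∈ l} ∧ G.Adj x v}.ncard := rfl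
    _ ≤ ((N.image fun i => l.getD i x : Finset V) : Set V).ncard :=
      Set.ncard_le_ncard hsub (Finset.finite_toSet _)
    _ ≤ N.card := by
      rw [Set.ncard_coe_finset]
      exact Finset.card_image_le

/-- If the degrees of `y` and `z` to a list of vertices are large, the list can be cut at two
places such that `y` is adjacent to each vertex before a cut and `z` to each vertex after one. -/
theorem exists_lt_cuts_of_length_add_two_le {V : Type*} (G : SimpleGraph V) (y z : V) (l : List V)
    (hd : l.length + 2 ≤ dOn G y {v | v ∈ l} + dOn G z {v | v ∈ l}) :
    ∃ A B C : List V, l = A ++ (B ++ C) ∧ (∀ v ∈ A.getLast?, G.Adj y v) ∧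
      (∀ v ∈ B.getLast?, G.Adj y v) ∧ (∀ v ∈ B.head?, G.Adj z v) ∧ (∀ v ∈ C.head?, G.Adj z v) ∧
      B ≠ [] := by
  classical
  set Y := (Finset.range l.length).filter fun i => ∀ v ∈ l[i]?, G.Adj y v with hY
  set Z := (Finset.range l.length).filter fun i => ∀ v ∈ l[i]?, G.Adj z v with hZ
  have hdY : dOn G y {v | v ∈ l} ≤ Y.card := dOn_le_card_filter_range G y l
  have hdZ : dOn G z {v | v ∈ l} ≤ Z.card := dOn_le_card_filter_range G z l
  set Y' := insert 0 (Y.image Nat.succ) with hY'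
  set Z' := insert l.length Z with hZ'
  have hcY : Y'.card = Y.card + 1 := by
    rw [hY', Finset.card_insert_of_notMem (by simp),
      Finset.card_image_of_injective _ Nat.succ_injective]
  have hcZ : Z'.card = Z.card + 1 := by
    rw [hZ', Finset.card_insert_of_notMem (by simp [hZ])]
  have hU : (Y' ∪ Z').card ≤ l.length + 1 := by
    rw [← Finset.card_range (l.length + 1)]
    apply Finset.card_le_card
    intro i hi
    simp only [hY', hZ', hY, hZ, Finset.mem_union, Finset.mem_insert, Finset.mem_image,
      Finset.mem_filter, Finset.mem_range] at hi ⊢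
    grind
  have hI := Finset.card_union_add_card_inter Y' Z'
  have hone : 1 < (Y' ∩ Z').card := by omega
  obtain ⟨i, hi, j, hj, hij⟩ : ∃ i ∈ Y' ∩ Z', ∃ j ∈ Y' ∩ Z', i < j := by
    obtain ⟨i, hi, j, hj, hne⟩ := Finset.one_lt_card.1 hone
    rcases lt_or_gt_of_ne hne with h | h
    exacts [⟨i, hi, j, hj, h⟩, ⟨j, hj, i, hi, h⟩]
  have key : ∀ i ∈ Y' ∩ Z', i ≤ l.length ∧ (∀ v ∈ (l.take i).getLast?, G.Adj y v) ∧
      ∀ v ∈ (l.drop i).head?, G.Adj z v := by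
    intro i hi
    simp only [hY', hZ', hY, hZ, Finset.mem_inter, Finset.mem_insert, Finset.mem_image,
      Finset.mem_filter, Finset.mem_range] at hi
    rw [List.getLast?_take, List.head?_drop]
    grind
  obtain ⟨-, hi1, hi2⟩ := key i hi
  obtain ⟨hjl, hj1, hj2⟩ := key j hj
  have hsplit : l.take j = l.take i ++ (l.take j).drop i := by
    conv_lhs => rw [← List.take_append_drop i (l.take j)]
    rw [List.take_take, min_eq_left hij.le]
  have hB : (l.take j).drop i ≠ [] := by
    simp only [ne_eq, List.drop_eq_nil_iff, List.length_take]
    omega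
  refine ⟨l.take i, (l.take j).drop i, l.drop j, ?_, hi1, ?_, ?_, hj2, hB⟩
  · rw [← List.append_assoc, ← hsplit, List.take_append_drop]
  · intro v hv
    apply hj1
    rw [hsplit, List.getLast?_append_of_ne_nil _ hB]
    exact hv
  · intro v hv
    apply hi2
    rw [List.head?_drop] at hv ⊢
    grind

/-- Lemma 2.1(d): if `P` is a path of `G` on `k` vertices, `y` and `z` are
distinct vertices outside `V(P)` and `d(y, V(P)) + d(z, V(P)) ≥ k + 2`, then
`G[V(P) ∪ {y, z}]` is traceable. -/
theorem stmt_7 {V : Type*} (G : SimpleGraph V) {a b : V}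
    (p : G.Walk a b) (hp : p.IsPath) (y z : V) (hyz : y ≠ z)
    (hy : y ∉ p.support) (hz : z ∉ p.support)
    (hd : p.support.length + 2 ≤
      dOn G y {v | v ∈ p.support} + dOn G z {v | v ∈ p.support}) :
    Traceable (G.induce (insert y (insert z {v | v ∈ p.support}))) := by
  obtain ⟨A, B, C, hl, hA, hB, hB', hC, hne⟩ := exists_lt_cuts_of_length_add_two_le G y z _ hd
  have hchain := p.isChain_adj_support
  have hnodup := hp.support_nodup
  rw [hl] at hchain hnodup hy hz
  have hmem : ∀ v, v ∈ p.support ↔ v ∈ A ∨ v ∈ B ∨ v ∈ C := by simp [hl]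
  apply traceable_induce_of_isChain (l := A ++ y :: (B.reverse ++ z :: C))
  · simp
  · rw [List.isChain_append, List.isChain_append] at hchain
    obtain ⟨hcA, ⟨hcB, hcC, -⟩, -⟩ := hchain
    have hcB' : B.reverse.IsChain G.Adj :=
      List.isChain_reverse.2 (hcB.imp fun _ _ h => h.symm)
    rw [List.isChain_append, List.isChain_cons, List.isChain_append, List.isChain_cons]
    refine ⟨hcA, ⟨?_, hcB', ⟨hC, hcC⟩, ?_⟩, ?_⟩
    · rw [List.head?_append_of_ne_nil _ (by simpa using hne), List.head?_reverse]
      exact hB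
    · rw [List.getLast?_reverse]
      simpa using fun v hv => (hB' v hv).symm
    · simpa using fun v hv => (hA v hv).symm
  · simp only [List.mem_append, not_or] at hy hz
    simp only [List.nodup_append, List.nodup_cons, List.mem_append, List.mem_cons,
      List.mem_reverse, List.nodup_reverse] at hnodup ⊢
    grind
  · intro v
    simp only [List.mem_append, List.mem_cons, List.mem_reverse, Set.mem_insert_iff,
      Set.mem_ofPred_eq, hmem]
    tauto
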